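/- Fix an increasing sequence (k_n)_{n≥1} of positive integers with k_n ≤ n for all n and k_n → ∞. Then the probability P_n⟨false⟩ that a uniformly random equivalence class of and/or trees of size n (using at most k_n distinct variables) computes the constant function false tends to 0 as n → ∞; equivalently, a random Catalan Boolean expression is satisfiable with probability tending to 1 as its size tends to infinity. -/

import Mathlib

open Filter

namespace CatalanSat

/-- A logical connective: `and` or `or`. -/
inductive Conn : Type
  | and : Conn
  | or : Conn

/-- An and/or tree: a binary plane tree with internal nodes labelled by a
connective and leaves labelled by a literal `(v, b)`: variable `v`, positive
if `b = true`, negated if `b = false`. -/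
inductive AOTree : Type
  | leaf (v : ℕ) (b : Bool) : AOTree
  | node (c : Conn) (l r : AOTree) : AOTree

namespace AOTree

/-- The list of leaf labels (variable index, polarity), from left to right. -/
def leaves : AOTree → List (ℕ × Bool)
  | .leaf v b => [(v, b)]
  | .node _ l r => leaves l ++ leaves r

/-- The size of an and/or tree is its number of leaves. -/
def size (t : AOTree) : ℕ := t.leaves.length

/-- The number of distinct variables appearing as leaf labels. -/
def varCount (t : AOTree) : ℕ := (t.leaves.map Prod.fst).toFinset.card

/-- The Boolean function computed by an and/or tree. -/
def eval : AOTree → (ℕ → Bool) → Bool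
  | .leaf v b, x => if b then x v else !(x v)
  | .node .and l r, x => eval l x && eval r x
  | .node .or l r, x => eval l x || eval r x

end AOTree

/-- A tree-structure: a binary plane tree with internal nodes labelled by a
connective and unlabelled leaves. -/
inductive Shape : Type
  | leaf : Shape
  | node (c : Conn) (l r : Shape) : Shape

/-- The size of a tree-structure is its number of leaves. -/
def Shape.size : Shape → ℕ
  | .leaf => 1
  | .node _ l r => Shape.size l + Shape.size r

/-- The tree-structure of an and/or tree (forget the leaf labels). -/
def AOTree.shape : AOTree → Shape
  | .leaf _ _ => .leaf
  | .node c l r => .node c l.shape r.shape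

/-- The label of the `i`-th leaf (junk default when out of range). -/
def lv (t : AOTree) (i : ℕ) : ℕ × Bool := t.leaves.getD i (0, true)

/-- Two and/or trees are equivalent when they have the same tree-structure,
two leaves are labelled by the same variable in one iff they are in the other,
and two leaves are labelled by the same literal in one iff they are in the other. -/
def TreeEquiv (A B : AOTree) : Prop :=
  A.shape = B.shape ∧
  ∀ i j : ℕ, i < A.leaves.length → j < A.leaves.length →
    (((lv A i).1 = (lv A j).1) ↔ ((lv B i).1 = (lv B j).1)) ∧
    ((lv A i = lv A j) ↔ (lv B i = lv B j))

/-- The equivalence relation on Boolean functions induced by equivalence of trees. -/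
def FunEquiv (f g : (ℕ → Bool) → Bool) : Prop :=
  ∃ A B : AOTree, TreeEquiv A B ∧ A.eval = f ∧ B.eval = g

/-- The number of equivalence classes of and/or trees satisfying a property
(the property being assumed invariant under equivalence). -/
noncomputable def classCount (P : AOTree → Prop) : ℕ :=
  Nat.card (Quot (fun A B : {t : AOTree // P t} => TreeEquiv A.1 B.1))

/-- `Tcount n K`: number of equivalence classes of and/or trees of size `n`
using at most `K` distinct variables. -/
noncomputable def Tcount (n K : ℕ) : ℕ := classCount fun t => t.size = n ∧ t.varCount ≤ K

/-- Number of such classes computing a function of the class `⟨f⟩`. -/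
noncomputable def TcountClass (n K : ℕ) (f : (ℕ → Bool) → Bool) : ℕ :=
  classCount fun t => t.size = n ∧ t.varCount ≤ K ∧ FunEquiv t.eval f

/-- `P_n⟨f⟩`: the probability that a uniform equivalence class of trees of size
`n` (at most `K` variables) computes a function of `⟨f⟩`. -/
noncomputable def Pclass (n K : ℕ) (f : (ℕ → Bool) → Bool) : ℝ :=
  (TcountClass n K f : ℝ) / (Tcount n K : ℝ)

/-- Number of classes of size `n`, at most `K` variables, computing exactly `f`. -/
noncomputable def TcountEval (n K : ℕ) (f : (ℕ → Bool) → Bool) : ℕ :=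
  classCount fun t => t.size = n ∧ t.varCount ≤ K ∧ t.eval = f

/-- Stirling numbers of the second kind. -/
def stirling : ℕ → ℕ → ℕ
  | 0, 0 => 1
  | 0, _ + 1 => 0
  | _ + 1, 0 => 0
  | n + 1, k + 1 => (k + 1) * stirling n (k + 1) + stirling n k

/-- `B n k = Σ_{p=1}^{k} S(n,p)·2^{−p}`. -/
noncomputable def B (n k : ℕ) : ℝ :=
  ∑ p ∈ Finset.Icc 1 k, (stirling n p : ℝ) / 2 ^ p

/-- `a n p = p^n/(p!·2^p)`. -/
noncomputable def a (n p : ℕ) : ℝ :=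
  (p : ℝ) ^ n / ((Nat.factorial p : ℝ) * 2 ^ p)

/-- `rat_n = B_{n−1,k_n}/B_{n,k_n}`. -/
noncomputable def rat (k : ℕ → ℕ) (n : ℕ) : ℝ := B (n - 1) (k n) / B n (k n)

/-- The complexity `L(f)`: minimal size of an and/or tree computing `f`. -/
noncomputable def complexity (f : (ℕ → Bool) → Bool) : ℕ :=
  sInf {m | ∃ t : AOTree, t.size = m ∧ t.eval = f}

/-- The variable `x_i` is essential for `f`. -/
def Essential (i : ℕ) (f : (ℕ → Bool) → Bool) : Prop :=
  ∃ x : ℕ → Bool, f (Function.update x i false) ≠ f (Function.update x i true)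

/-- `E(f)`: the number of essential variables of `f`. -/
noncomputable def essCount (f : (ℕ → Bool) → Bool) : ℕ :=
  Nat.card {i : ℕ // Essential i f}

/-- The multiplicity `R⟨f⟩ = L⟨f⟩ − E⟨f⟩`. -/
noncomputable def mult (f : (ℕ → Bool) → Bool) : ℕ := complexity f - essCount f

/-- `M` is, for each `n ≥ 1`, an index of `{1,…,n}` maximizing `p ↦ p^n/(p!·2^p)`. -/
def IsArgmax (M : ℕ → ℕ) : Prop :=
  ∀ n, 1 ≤ n → M n ∈ Finset.Icc 1 n ∧ ∀ p ∈ Finset.Icc 1 n, a n p ≤ a n (M n)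

/-- There is a leaf labelled by the given literal linked to the root by
`∨`-labelled internal nodes only. -/
def orLeaf : AOTree → ℕ × Bool → Prop
  | .leaf v b, l => (v, b) = l
  | .node .or A B, l => orLeaf A l ∨ orLeaf B l
  | .node .and _ _, _ => False

/-- There is a leaf labelled by the given literal linked to the root by
`∧`-labelled internal nodes only. -/
def andLeaf : AOTree → ℕ × Bool → Prop
  | .leaf v b, l => (v, b) = l
  | .node .and A B, l => andLeaf A l ∨ andLeaf B l
  | .node .or _ _, _ => False

/-- A simple tautology: two leaves labelled by a variable and its negation,
both linked to the root through `∨`-connectives only. -/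
def IsSimpleTautology (t : AOTree) : Prop :=
  ∃ v b, orLeaf t (v, b) ∧ orLeaf t (v, !b)

/-- A simple contradiction: the dual notion. -/
def IsSimpleContradiction (t : AOTree) : Prop :=
  ∃ v b, andLeaf t (v, b) ∧ andLeaf t (v, !b)

/-- A tautology: a tree computing the constant function `true`. -/
def IsTautology (t : AOTree) : Prop := ∀ x : ℕ → Bool, t.eval x = true

/-- A simple-x of type T: one subtree of the root is a single leaf, the other
is a simple tautology if the root is `∧`, a simple contradiction if it is `∨`. -/
def IsSimpleXT (t : AOTree) : Prop :=
  (∃ v b s, (t = .node .and (.leaf v b) s ∨ t = .node .and s (.leaf v b)) ∧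
    IsSimpleTautology s) ∨
  (∃ v b s, (t = .node .or (.leaf v b) s ∨ t = .node .or s (.leaf v b)) ∧
    IsSimpleContradiction s)

/-- A simple-x of type X: one subtree of the root is a single leaf `ℓ`, the root
is `∧` (resp. `∨`), and the other subtree has a leaf labelled by the literal of
`ℓ` linked to its root by `∨`-only (resp. `∧`-only) internal nodes. -/
def IsSimpleXX (t : AOTree) : Prop :=
  (∃ v b s, (t = .node .and (.leaf v b) s ∨ t = .node .and s (.leaf v b)) ∧
    orLeaf s (v, b)) ∨
  (∃ v b s, (t = .node .or (.leaf v b) s ∨ t = .node .or s (.leaf v b)) ∧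
    andLeaf s (v, b))

open Finset.HasAntidiagonal (antidiagonal mem_antidiagonal)

/-! ### Counting tree-structures -/

/-- The finset of tree-structures with `m` internal nodes. -/
noncomputable def shapes : ℕ → Finset Shape
  | 0 => {Shape.leaf}
  | m + 1 => by
    classical
    exact (antidiagonal m).attach.biUnion fun ij =>
      (shapes ij.1.1 ×ˢ shapes ij.1.2).image (fun lr => Shape.node .and lr.1 lr.2) ∪
      (shapes ij.1.1 ×ˢ shapes ij.1.2).image (fun lr => Shape.node .or lr.1 lr.2)
  decreasing_by
    all_goals
      have := mem_antidiagonal.1 ij.2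
      omega

lemma shapes_zero : shapes 0 = {Shape.leaf} := by rw [shapes]

lemma Shape.size_pos (s : Shape) : 0 < s.size := by
  induction s with
  | leaf => simp [Shape.size]
  | node c l r hl hr => simp only [Shape.size]; omega

lemma mem_shapes (s : Shape) : ∀ m, s ∈ shapes m ↔ s.size = m + 1 := by
  induction s with
  | leaf =>
    intro m
    cases m with
    | zero => simp [shapes_zero, Shape.size]
    | succ m => rw [shapes]; simp [Shape.size]
  | node c l r hl hr =>
    intro m
    cases m with
    | zero =>
      have := l.size_pos
      have := r.size_pos
      simp only [shapes_zero, Shape.size, Finset.mem_singleton, reduceCtorEq, false_iff]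
      omega
    | succ m =>
      have h1 := l.size_pos
      have h2 := r.size_pos
      rw [shapes]
      simp only [Finset.mem_biUnion, Finset.mem_attach, true_and, Finset.mem_union,
        Finset.mem_image, Finset.mem_product, Subtype.exists, Prod.exists,
        mem_antidiagonal, Shape.node.injEq, Shape.size]
      constructor
      · rintro ⟨i, j, hij, ⟨l', r', ⟨ha, hb⟩, -, rfl, rfl⟩ | ⟨l', r', ⟨ha, hb⟩, -, rfl, rfl⟩⟩
        all_goals simp only [hl, hr] at ha hb; omega
      · intro h
        refine ⟨l.size - 1, r.size - 1, by omega, ?_⟩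
        cases c
        · exact Or.inl ⟨l, r, ⟨(hl _).2 (by omega), (hr _).2 (by omega)⟩, rfl, rfl, rfl⟩
        · exact Or.inr ⟨l, r, ⟨(hl _).2 (by omega), (hr _).2 (by omega)⟩, rfl, rfl, rfl⟩

lemma sum_shapes_succ (f : Shape → ℕ) (m : ℕ) :
    ∑ s ∈ shapes (m + 1), f s = ∑ ij ∈ antidiagonal m,
      ∑ l ∈ shapes ij.1, ∑ r ∈ shapes ij.2, (f (.node .and l r) + f (.node .or l r)) := by
  classical
  rw [shapes, Finset.sum_biUnion, Finset.sum_attach (antidiagonal m) (fun ij =>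
    ∑ s ∈ (shapes ij.1 ×ˢ shapes ij.2).image (fun lr => Shape.node .and lr.1 lr.2) ∪
      (shapes ij.1 ×ˢ shapes ij.2).image (fun lr => Shape.node .or lr.1 lr.2), f s)]
  · refine Finset.sum_congr rfl fun ij _ => ?_
    rw [Finset.sum_union, Finset.sum_image, Finset.sum_image, Finset.sum_product,
      Finset.sum_product, ← Finset.sum_add_distrib]
    · exact Finset.sum_congr rfl fun l _ => Finset.sum_add_distrib.symm
    · rintro ⟨a, b⟩ - ⟨c, d⟩ - h
      simpa using h
    · rintro ⟨a, b⟩ - ⟨c, d⟩ - h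
      simpa using h
    · rw [Finset.disjoint_left]
      intro s hs hs'
      simp only [Finset.mem_image] at hs hs'
      obtain ⟨x, -, rfl⟩ := hs
      obtain ⟨y, -, h⟩ := hs'
      simp at h
  · intro ij _ ij' _ hne
    refine Finset.disjoint_left.2 fun s hs hs' => hne (Subtype.ext (Prod.ext ?_ ?_))
    all_goals
      cases s with
      | leaf => simp at hs
      | node c l r =>
        simp only [Finset.mem_union, Finset.mem_image, Finset.mem_product, mem_shapes,
          Prod.exists, Shape.node.injEq] at hs hs'
        obtain ⟨_, _, ⟨h1, h2⟩, -, rfl, rfl⟩ | ⟨_, _, ⟨h1, h2⟩, -, rfl, rfl⟩ := hs <;>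
        obtain ⟨_, _, ⟨h3, h4⟩, -, rfl, rfl⟩ | ⟨_, _, ⟨h3, h4⟩, -, rfl, rfl⟩ := hs' <;>
        omega

lemma card_shapes_succ (m : ℕ) :
    (shapes (m + 1)).card =
      2 * ∑ ij ∈ antidiagonal m, (shapes ij.1).card * (shapes ij.2).card := by
  have := sum_shapes_succ (fun _ => 1) m
  simp only [Finset.sum_const, smul_eq_mul, mul_one] at this
  rw [this, Finset.mul_sum]
  exact Finset.sum_congr rfl fun _ _ => by ring

lemma card_shapes (m : ℕ) : (shapes m).card = 2 ^ m * catalan m := by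
  induction m using Nat.strong_induction_on with
  | _ m ih =>
    cases m with
    | zero => simp [shapes_zero]
    | succ m =>
      rw [card_shapes_succ, catalan_succ', Finset.mul_sum, Finset.mul_sum]
      refine Finset.sum_congr rfl fun ij hij => ?_
      have h := mem_antidiagonal.1 hij
      rw [ih ij.1 (by omega), ih ij.2 (by omega), ← h]
      ring

lemma catalan_succ_le (m : ℕ) : catalan (m + 1) ≤ 4 * catalan m := by
  have h1 := succ_mul_catalan_eq_centralBinom m
  have h2 := succ_mul_catalan_eq_centralBinom (m + 1)
  have h3 := Nat.succ_mul_centralBinom_succ m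
  rw [← h1, ← h2] at h3
  by_contra! h
  have h5 : (m + 1) * ((m + 1 + 1) * catalan (m + 1)) =
    (m + 1) * (2 * (2 * m + 1) * catalan m) := by rw [h3]; ring
  have h6 := Nat.eq_of_mul_eq_mul_left (Nat.succ_pos m) h5
  nlinarith

lemma card_shapes_succ_le (m : ℕ) : (shapes (m + 1)).card ≤ 8 * (shapes m).card := by
  have := catalan_succ_le m
  rw [card_shapes, card_shapes, pow_succ]
  nlinarith [pow_pos (two_pos : (0 : ℕ) < 2) m]

/-- A set of leaf positions whose literals, if all true, make the tree true: both subtrees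
contribute at an `∧`-node, only the left one at an `∨`-node. -/
def cert : Shape → Finset ℕ
  | .leaf => {0}
  | .node .and l r => cert l ∪ (cert r).image (fun i => l.size + i)
  | .node .or l _ => cert l

lemma lt_size_of_mem_cert (s : Shape) : ∀ i ∈ cert s, i < s.size := by
  induction s with
  | leaf => simp [cert, Shape.size]
  | node c l r hl hr =>
    intro i hi
    cases c with
    | and =>
      simp only [cert, Finset.mem_union, Finset.mem_image, Shape.size] at hi ⊢
      obtain hi | ⟨j, hj, rfl⟩ := hi
      · have := hl i hi; omega
      · have := hr j hj; omega
    | or =>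
      have := hl i hi
      simp only [Shape.size]; omega

lemma card_cert_and_le (l r : Shape) :
    (cert (.node .and l r)).card ≤ (cert l).card + (cert r).card :=
  (Finset.card_union_le _ _).trans (Nat.add_le_add_left Finset.card_image_le _)

/-- The total size of the certificates over all tree-structures with `m` internal nodes. -/
noncomputable def certSum (m : ℕ) : ℕ := ∑ s ∈ shapes m, (cert s).card

lemma certSum_succ_le (m : ℕ) :
    certSum (m + 1) ≤ 3 * ∑ ij ∈ antidiagonal m, certSum ij.1 * (shapes ij.2).card := by
  have key : certSum (m + 1) ≤ ∑ ij ∈ antidiagonal m,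
      (2 * (certSum ij.1 * (shapes ij.2).card) + certSum ij.2 * (shapes ij.1).card) := by
    rw [certSum, sum_shapes_succ]
    refine Finset.sum_le_sum fun ij _ => ?_
    calc _ ≤ ∑ l ∈ shapes ij.1, ∑ r ∈ shapes ij.2, (2 * (cert l).card + (cert r).card) := by
          refine Finset.sum_le_sum fun l _ => Finset.sum_le_sum fun r _ => ?_
          have h1 := card_cert_and_le l r
          have h2 : (cert (.node .or l r)).card = (cert l).card := rfl
          omega
      _ = _ := by
          simp only [Finset.sum_add_distrib, Finset.sum_const, smul_eq_mul, certSum,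
            ← Finset.mul_sum]
          ring
  have hswap : ∑ ij ∈ antidiagonal m, certSum ij.2 * (shapes ij.1).card =
      ∑ ij ∈ antidiagonal m, certSum ij.1 * (shapes ij.2).card :=
    Finset.Nat.sum_antidiagonal_swap
      (f := fun ij : ℕ × ℕ => certSum ij.1 * (shapes ij.2).card)
  rw [Finset.sum_add_distrib, hswap, ← Finset.mul_sum] at key
  omega

/-- The average certificate size is bounded independently of the size of the trees. -/
lemma certSum_le (m : ℕ) : certSum m ≤ 39 * (shapes m).card := by
  have n0 : (shapes 0).card = 1 := by simp [shapes_zero]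
  have n1 : (shapes 1).card = 2 := by simp [card_shapes]
  have n2 : (shapes 2).card = 8 := by simp [card_shapes, catalan_two]
  have s0 : certSum 0 = 1 := by simp [certSum, shapes_zero, cert]
  have s1 : certSum 1 ≤ 3 := by
    simpa [s0, n0] using certSum_succ_le 0
  have s2 : certSum 2 ≤ 15 := by
    have := certSum_succ_le 1
    simp [Finset.Nat.antidiagonal_succ, s0, n0, n1] at this
    omega
  induction m using Nat.strong_induction_on with
  | _ m ih =>
    rcases m with _ | _ | _ | m
    · omega
    · simp only [zero_add]; omega
    · simp only [zero_add, Nat.reduceAdd]; omega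
    · have hS := certSum_succ_le (m + 2)
      have hN := card_shapes_succ (m + 2)
      rw [Finset.Nat.sum_antidiagonal_eq_sum_range_succ_mk, Finset.sum_range_succ',
        Finset.sum_range_succ', Finset.sum_range_succ'] at hS hN
      simp only [Nat.reduceAdd, zero_add, s0, n0, n1, n2,
        show m + 2 - 0 = m + 2 by omega, show m + 2 - 1 = m + 1 by omega,
        show m + 2 - 2 = m by omega, add_assoc] at hS hN
      have hle : ∑ k ∈ Finset.range m, certSum (k + 3) * (shapes (m + 2 - (k + 3))).card ≤
          39 * ∑ k ∈ Finset.range m,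
            (shapes (k + 3)).card * (shapes (m + 2 - (k + 3))).card := by
        rw [Finset.mul_sum]
        refine Finset.sum_le_sum fun k hk => ?_
        rw [← mul_assoc]
        have := Finset.mem_range.1 hk
        exact Nat.mul_le_mul_right _ (ih _ (by omega))
      have h1 := card_shapes_succ_le m
      have h2 := card_shapes_succ_le (m + 1)
      have h3 := card_shapes_succ_le (m + 2)
      have e1 : certSum 1 * (shapes (m + 1)).card ≤ 3 * (shapes (m + 1)).card :=
        Nat.mul_le_mul_right _ s1
      have e2 : certSum 2 * (shapes m).card ≤ 15 * (shapes m).card :=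
        Nat.mul_le_mul_right _ s2
      simp only [add_assoc, Nat.reduceAdd] at h1 h2 h3 ⊢
      omega

/-! ### Labellings up to equivalence -/

/-- The pattern of coincidences of variables and of literals in a word of literals. -/
def pattern {α : Type*} {n : ℕ} (w : Fin n → α × Bool) : Fin n → Fin n → Prop × Prop :=
  fun i j => ((w i).1 = (w j).1, w i = w j)

lemma pattern_eq_iff {α β : Type*} {n : ℕ} (w : Fin n → α × Bool) (w' : Fin n → β × Bool) :
    pattern w = pattern w' ↔ ∀ i j, ((w i).1 = (w j).1 ↔ (w' i).1 = (w' j).1) ∧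
      (w i = w j ↔ w' i = w' j) := by
  simp only [funext_iff, pattern, Prod.mk.injEq, eq_iff_iff]

/-- The number of distinct variables in a word of literals. -/
def wordVars {n : ℕ} (w : Fin n → ℕ × Bool) : ℕ := (Finset.univ.image fun i => (w i).1).card

/-- The patterns of words of length `n` with at most `K` variables. -/
def patterns (n K : ℕ) : Set (Fin n → Fin n → Prop × Prop) :=
  pattern '' {w : Fin n → ℕ × Bool | wordVars w ≤ K}

/-- The patterns of words with at most `K` variables in which positions `i` and `j` carry
opposite literals. -/
def clashPatterns (n K : ℕ) (i j : Fin n) : Set (Fin n → Fin n → Prop × Prop) :=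
  pattern '' {w : Fin n → ℕ × Bool | wordVars w ≤ K ∧ w j = ((w i).1, !(w i).2)}

lemma ncard_patterns_le (n p : ℕ) : (patterns n p).ncard ≤ (2 * p) ^ n := by
  have hsub : patterns n p ⊆
      Set.range (fun u : Fin n → Fin p × Bool => pattern u) := by
    rintro _ ⟨w, hw, rfl⟩
    let V := Finset.univ.image fun i => (w i).1
    have hV : ∀ i, (w i).1 ∈ V := fun i => Finset.mem_image_of_mem _ (Finset.mem_univ i)
    obtain ⟨e⟩ : Nonempty (V ↪ Fin p) := by
      refine Function.Embedding.nonempty_of_card_le ?_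
      simpa [V, wordVars] using hw
    refine ⟨fun i => (e ⟨(w i).1, hV i⟩, (w i).2), ?_⟩
    rw [pattern_eq_iff]
    intro i j
    simp [Prod.ext_iff]
  calc (patterns n p).ncard
      ≤ (Set.range (fun u : Fin n → Fin p × Bool => pattern u)).ncard :=
        Set.ncard_le_ncard hsub (Set.toFinite _)
    _ ≤ Nat.card (Fin n → Fin p × Bool) := by
        rw [← Set.image_univ, ← Set.ncard_univ]
        exact Set.ncard_image_le (Set.toFinite _)
    _ = (2 * p) ^ n := by simp [mul_comm]

lemma le_ncard_patterns {n K q : ℕ} (hK : q ≤ K) (hn : q ≤ n) :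
    (2 * q) ^ (n - q) ≤ (patterns n K).ncard := by
  let W : (Fin (n - q) → Fin q × Bool) → Fin n → ℕ × Bool := fun u i =>
    if h : (i : ℕ) < q then ((i : ℕ), true)
    else (((u ⟨i - q, by omega⟩).1 : ℕ), (u ⟨i - q, by omega⟩).2)
  have hW : ∀ u, pattern (W u) ∈ patterns n K := by
    intro u
    refine ⟨W u, ?_, rfl⟩
    refine le_trans ?_ hK
    calc wordVars (W u) ≤ (Finset.range q).card := by
          refine Finset.card_le_card fun v hv => ?_
          obtain ⟨i, -, rfl⟩ := Finset.mem_image.1 hv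
          simp only [W]
          split_ifs with h
          · simpa using h
          · simp
      _ = q := Finset.card_range q
  have hinj : Function.Injective fun u => (⟨pattern (W u), hW u⟩ : patterns n K) := by
    intro u u' h
    rw [Subtype.mk.injEq, pattern_eq_iff] at h
    funext a
    have ha := (u a).1.2
    have hin : q + (a : ℕ) < n := by omega
    have e1 : ∀ u, W u ⟨q + a, hin⟩ = (((u a).1 : ℕ), (u a).2) := by
      intro u
      simp [W]
    have e2 : ∀ u, W u ⟨(u a).1, (u a).1.2.trans_le hn⟩ = (((u a).1 : ℕ), true) := by
      intro u; simp [W]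
    have e3 : W u' ⟨(u a).1, (u a).1.2.trans_le hn⟩ = (((u a).1 : ℕ), true) := by
      simp [W]
    obtain ⟨h1, h2⟩ := h ⟨q + a, hin⟩ ⟨(u a).1, (u a).1.2.trans_le hn⟩
    rw [e1, e1, e2, e3] at h1 h2
    have h3 := h1.1 rfl
    simp only [Prod.mk.injEq, true_and] at h2
    refine Prod.ext (Fin.ext h3.symm) ?_
    simp only at h3
    rw [h3] at h2
    simp only [true_and] at h2
    cases hx : (u a).2 <;> cases hy : (u' a).2 <;> simp_all
  have := Nat.card_le_card_of_injective _ hinj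
  simpa [mul_comm, Nat.card_coe_set_eq] using this

lemma exists_distinct_vars {n p : ℕ} (w : Fin n → ℕ × Bool) (hw : p + 1 ≤ wordVars w)
    (v : ℕ) : ∃ g : Fin p → Fin n, (∀ a b, (w (g a)).1 = (w (g b)).1 → a = b) ∧
      ∀ a, (w (g a)).1 ≠ v := by
  let V := (Finset.univ.image fun i => (w i).1).erase v
  have hV : p ≤ V.card := by
    have := Finset.pred_card_le_card_erase (a := v) (s := Finset.univ.image fun i => (w i).1)
    exact (Nat.le_sub_one_of_lt hw).trans this
  obtain ⟨e⟩ : Nonempty (Fin p ↪ V) := Function.Embedding.nonempty_of_card_le (by simpa using hV)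
  have h : ∀ a, ∃ i, (w i).1 = (e a : ℕ) := fun a => by
    simpa using (Finset.mem_erase.1 (e a).2).2
  choose g hg using h
  refine ⟨g, fun a b hab => ?_, fun a => ?_⟩
  · rw [hg, hg] at hab
    exact e.injective (Subtype.ext hab)
  · rw [hg]
    exact (Finset.mem_erase.1 (e a).2).1

/-- Opposite literals at two given positions are rare among words with many variables: the
second position can be relabelled by any other variable. -/
lemma mul_ncard_clash_le {n K p : ℕ} {i j : Fin n} (hij : i ≠ j) :
    p * (pattern '' {w : Fin n → ℕ × Bool | (wordVars w ≤ K ∧ w j = ((w i).1, !(w i).2)) ∧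
      p + 1 ≤ wordVars w}).ncard ≤ (patterns n K).ncard := by
  set S := pattern '' {w : Fin n → ℕ × Bool | (wordVars w ≤ K ∧ w j = ((w i).1, !(w i).2)) ∧
      p + 1 ≤ wordVars w}
  have hch : ∀ κ : S, ∃ w : Fin n → ℕ × Bool, ((wordVars w ≤ K ∧ w j = ((w i).1, !(w i).2)) ∧
      p + 1 ≤ wordVars w) ∧ pattern w = κ := fun κ => κ.2
  choose w hw hwκ using hch
  choose g hg hgv using fun κ : S => exists_distinct_vars (w κ) (hw κ).2 ((w κ) i).1
  let F : Fin p × S → Fin n → ℕ × Bool := fun x =>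
    Function.update (w x.2) j (w x.2 (g x.2 x.1))
  have hF : ∀ x, pattern (F x) ∈ patterns n K := by
    intro x
    refine ⟨F x, le_trans (Finset.card_le_card fun v hv => ?_) (hw x.2).1.1, rfl⟩
    obtain ⟨a, -, rfl⟩ := Finset.mem_image.1 hv
    by_cases ha : a = j
    · subst ha
      simp [F]
    · simp [F, Function.update_of_ne ha]
  have hinj : Function.Injective fun x => (⟨pattern (F x), hF x⟩ : patterns n K) := by
    rintro ⟨a, κ⟩ ⟨b, κ'⟩ h
    rw [Subtype.mk.injEq, pattern_eq_iff] at h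
    have hκ : κ = κ' := by
      refine Subtype.ext ?_
      rw [← hwκ κ, ← hwκ κ', pattern_eq_iff]
      have off : ∀ c d, c ≠ j → d ≠ j →
          ((w κ c).1 = (w κ d).1 ↔ (w κ' c).1 = (w κ' d).1) ∧
          (w κ c = w κ d ↔ w κ' c = w κ' d) := by
        intro c d hc hd
        simpa [F, Function.update_of_ne hc, Function.update_of_ne hd] using h c d
      have opp : ∀ (x y : ℕ × Bool), ((x.1, !x.2) = y ↔ x.1 = y.1 ∧ ¬ x = y) := by
        rintro ⟨x, s⟩ ⟨y, t⟩
        cases s <;> cases t <;> simp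
      intro c d
      by_cases hc : c = j <;> by_cases hd : d = j
      · subst hc; subst hd; simp
      · subst hc
        obtain ⟨h1, h2⟩ := off i d hij hd
        rw [(hw κ).1.2, (hw κ').1.2, opp, opp, ← h1, ← h2]
        exact ⟨Iff.rfl, Iff.rfl⟩
      · subst hd
        obtain ⟨h1, h2⟩ := off i c hij hc
        rw [eq_comm, @eq_comm _ (w κ' c).1, @eq_comm _ (w κ c), @eq_comm _ (w κ' c),
          (hw κ).1.2, (hw κ').1.2, opp, opp, ← h1, ← h2]
        exact ⟨Iff.rfl, Iff.rfl⟩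
      · exact off c d hc hd
    subst hκ
    have hne : g κ a ≠ j := by
      intro hj
      have := hgv κ a
      rw [hj, (hw κ).1.2] at this
      exact this rfl
    have h1 := (h j (g κ a)).1
    simp only [F, Function.update_self, Function.update_of_ne hne, true_iff] at h1
    rw [hg κ b a h1]
  have := Nat.card_le_card_of_injective _ hinj
  simpa [Nat.card_prod, Nat.card_coe_set_eq] using this

lemma mul_ncard_clashPatterns_le {n K p : ℕ} {i j : Fin n} (hij : i ≠ j) :
    p * (clashPatterns n K i j).ncard ≤ (patterns n K).ncard + p * (2 * p) ^ n := by
  set S := pattern '' {w : Fin n → ℕ × Bool | (wordVars w ≤ K ∧ w j = ((w i).1, !(w i).2)) ∧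
      p + 1 ≤ wordVars w}
  have hsub : clashPatterns n K i j ⊆ S ∪ patterns n p := by
    rintro _ ⟨w, hw, rfl⟩
    by_cases h : p + 1 ≤ wordVars w
    · exact Or.inl ⟨w, ⟨hw, h⟩, rfl⟩
    · exact Or.inr ⟨w, by simp only [Set.mem_ofPred_eq]; omega, rfl⟩
  have h1 : (clashPatterns n K i j).ncard ≤ S.ncard + (2 * p) ^ n :=
    ((Set.ncard_le_ncard hsub (Set.toFinite _)).trans (Set.ncard_union_le _ _)).trans
      (Nat.add_le_add_left (ncard_patterns_le n p) _)
  calc _ ≤ p * (S.ncard + (2 * p) ^ n) := Nat.mul_le_mul_left _ h1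
    _ = p * S.ncard + p * (2 * p) ^ n := mul_add _ _ _
    _ ≤ _ := Nat.add_le_add_right (mul_ncard_clash_le hij) _

lemma eventually_clashPatterns_le {k : ℕ → ℕ} (hk : Tendsto k atTop atTop) {δ : ℝ}
    (hδ : 0 < δ) : ∀ᶠ n in atTop, ∀ i j : Fin n, i ≠ j →
      ((clashPatterns n (k n) i j).ncard : ℝ) ≤ δ * (patterns n (k n)).ncard := by
  obtain ⟨p, hp⟩ := exists_nat_gt (2 / δ)
  have hp0 : (0 : ℝ) < p := lt_trans (by positivity) hp
  have hpow : Tendsto (fun n : ℕ => (2 : ℝ) ^ n) atTop atTop :=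
    tendsto_pow_atTop_atTop_of_one_lt one_lt_two
  filter_upwards [hk.eventually_ge_atTop (2 * p), eventually_ge_atTop (2 * p),
    hpow.eventually_ge_atTop (p * (4 * p : ℝ) ^ (2 * p))] with n hkn hn hbig i j hij
  have h1 : (p : ℝ) * (clashPatterns n (k n) i j).ncard ≤
      (patterns n (k n)).ncard + p * (2 * p) ^ n := by
    exact_mod_cast mul_ncard_clashPatterns_le (p := p) (K := k n) hij
  have h2 : (4 * p : ℝ) ^ (n - 2 * p) ≤ (patterns n (k n)).ncard := by
    have := le_ncard_patterns hkn hn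
    rw [← mul_assoc] at this
    exact_mod_cast this
  have h3 : (p : ℝ) * (2 * p) ^ n ≤ (patterns n (k n)).ncard := by
    have e : (2 : ℝ) ^ n * (2 * p : ℝ) ^ n = (4 * p : ℝ) ^ (2 * p) * (4 * p : ℝ) ^ (n - 2 * p) := by
      rw [← mul_pow, ← pow_add, Nat.add_sub_cancel' hn]
      ring
    have e2 : (p : ℝ) * (4 * p : ℝ) ^ (2 * p) * (2 * p) ^ n ≤
        (4 * p : ℝ) ^ (2 * p) * (4 * p : ℝ) ^ (n - 2 * p) := by
      rw [← e]; gcongr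
    have hpos : (0 : ℝ) < (4 * p : ℝ) ^ (2 * p) := by positivity
    refine le_trans ?_ h2
    refine le_of_mul_le_mul_left ?_ hpos
    linarith
  have h4 : 2 ≤ p * δ := by
    rw [div_lt_iff₀ hδ] at hp
    exact hp.le
  refine le_of_mul_le_mul_left ?_ hp0
  have : (0 : ℝ) ≤ (patterns n (k n)).ncard := Nat.cast_nonneg _
  nlinarith

/-! ### Trees as labelled tree-structures -/

lemma shape_size (t : AOTree) : t.shape.size = t.leaves.length := by
  induction t with
  | leaf v b => rfl
  | node c l r hl hr => simp [AOTree.shape, AOTree.leaves, Shape.size, hl, hr]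

lemma lv_node_left {c : Conn} {l r : AOTree} {i : ℕ} (hi : i < l.shape.size) :
    lv (.node c l r) i = lv l i := by
  rw [shape_size] at hi
  exact List.getD_append _ _ _ _ hi

lemma lv_node_right {c : Conn} {l r : AOTree} (i : ℕ) :
    lv (.node c l r) (l.shape.size + i) = lv r i := by
  rw [lv, AOTree.leaves, shape_size, List.getD_append_right _ _ _ _ (Nat.le_add_right _ _),
    Nat.add_sub_cancel_left, lv]

/-- Label the leaves of a tree-structure by the letters of a word. -/
def Shape.label : Shape → (ℕ → ℕ × Bool) → AOTree
  | .leaf, w => .leaf (w 0).1 (w 0).2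
  | .node c l r, w => .node c (l.label w) (r.label fun i => w (l.size + i))

lemma shape_label (s : Shape) : ∀ w, (s.label w).shape = s := by
  induction s with
  | leaf => intro w; rfl
  | node c l r hl hr => intro w; simp [Shape.label, AOTree.shape, hl, hr]

lemma lv_label (s : Shape) : ∀ w, ∀ i < s.size, lv (s.label w) i = w i := by
  induction s with
  | leaf =>
    intro w i hi
    obtain rfl : i = 0 := by simpa [Shape.size] using hi
    rfl
  | node c l r hl hr =>
    intro w i hi
    rcases lt_or_ge i l.size with h | h
    · rw [Shape.label, lv_node_left (by rwa [shape_label]), hl w i h]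
    · obtain ⟨j, rfl⟩ := Nat.exists_eq_add_of_le h
      have hj : j < r.size := by simp only [Shape.size] at hi; omega
      have := lv_node_right (c := c) (l := l.label w) (r := r.label fun i => w (l.size + i)) j
      rw [shape_label] at this
      rw [Shape.label, this, hr _ j hj]

lemma varCount_eq {n : ℕ} {t : AOTree} (ht : t.size = n) :
    t.varCount = wordVars fun i : Fin n => lv t i := by
  subst ht
  rw [AOTree.varCount, wordVars]
  congr 1
  ext v
  simp only [List.mem_toFinset, List.mem_map, Finset.mem_image, Finset.mem_univ, true_and]
  constructor
  · rintro ⟨x, hx, rfl⟩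
    obtain ⟨i, hi, rfl⟩ := List.mem_iff_getElem.1 hx
    exact ⟨⟨i, hi⟩, by simp [lv, hi]⟩
  · rintro ⟨⟨i, hi⟩, rfl⟩
    have hi' : i < t.leaves.length := hi
    exact ⟨t.leaves[i], List.getElem_mem hi', by simp [lv, hi']⟩

/-- A tree is true as soon as all literals in the certificate of its structure are true. -/
lemma eval_of_cert (t : AOTree) (x : ℕ → Bool)
    (h : ∀ i ∈ cert t.shape, x (lv t i).1 = (lv t i).2) : t.eval x = true := by
  induction t with
  | leaf v b =>
    have := h 0 (by simp [AOTree.shape, cert])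
    simp only [lv, AOTree.leaves, List.getD_cons_zero] at this
    cases b <;> simp [AOTree.eval, this]
  | node c l r hl hr =>
    have hl' : cert l.shape ⊆ cert (AOTree.node c l r).shape := by
      cases c
      · exact Finset.subset_union_left
      · exact Finset.Subset.refl _
    have el : l.eval x = true := by
      refine hl fun i hi => ?_
      have := h i (hl' hi)
      rwa [lv_node_left (lt_size_of_mem_cert _ i hi)] at this
    cases c with
    | and =>
      have er : r.eval x = true := by
        refine hr fun i hi => ?_
        have := h (l.shape.size + i)
          (Finset.mem_union_right _ (Finset.mem_image_of_mem _ hi))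
        rwa [lv_node_right] at this
      simp [AOTree.eval, el, er]
    | or => simp [AOTree.eval, el]

lemma exists_clash {t : AOTree} (h : t.eval = fun _ => false) :
    ∃ i ∈ cert t.shape, ∃ j ∈ cert t.shape, lv t j = ((lv t i).1, !(lv t i).2) := by
  classical
  by_contra! hc
  have := eval_of_cert t (fun v => decide (∃ i ∈ cert t.shape, lv t i = (v, true)))
    (fun i hi => by
      rcases hb : (lv t i).2 with _ | _
      · simp only [decide_eq_false_iff_not]
        rintro ⟨j, hj, hji⟩
        exact hc i hi j hj (by rw [hji, hb]; rfl)
      · simp only [decide_eq_true_eq]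
        exact ⟨i, hi, by rw [← hb]⟩)
  rw [h] at this
  simp at this

/-- The structure of a tree together with the pattern of its labels. -/
def code (n : ℕ) (t : AOTree) : Shape × (Fin n → Fin n → Prop × Prop) :=
  (t.shape, pattern fun i : Fin n => lv t i)

lemma treeEquiv_iff {n : ℕ} {A B : AOTree} (hA : A.size = n) :
    TreeEquiv A B ↔ code n A = code n B := by
  subst hA
  rw [TreeEquiv, code, code, Prod.mk.injEq, pattern_eq_iff]
  refine and_congr_right fun _ => ⟨fun h i j => h i j i.2 j.2, fun h i j hi hj => ?_⟩
  exact h ⟨i, hi⟩ ⟨j, hj⟩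

lemma classCount_eq {n : ℕ} {P : AOTree → Prop} (hP : ∀ t, P t → t.size = n) :
    classCount P = (code n '' {t | P t}).ncard := by
  have h : (fun A B : {t : AOTree // P t} => TreeEquiv A.1 B.1) =
      ⇑(Setoid.ker fun A : {t : AOTree // P t} => code n A.1) := by
    funext A B
    rw [treeEquiv_iff (hP _ A.2)]
    rfl
  rw [classCount, h, ← Nat.card_coe_set_eq]
  refine (Nat.card_congr (Setoid.quotientKerEquivRange _)).trans (Nat.card_congr
    (Equiv.setCongr ?_))
  ext x
  simp

lemma Tcount_eq (m K : ℕ) :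
    Tcount (m + 1) K = (shapes m).card * (patterns (m + 1) K).ncard := by
  rw [Tcount, classCount_eq (n := m + 1) (fun t ht => ht.1), ← Set.ncard_coe_finset,
    ← Set.ncard_prod]
  congr 1
  ext ⟨s, κ⟩
  simp only [Set.mem_image, Set.mem_ofPred_eq, Set.mem_prod, Finset.mem_coe, mem_shapes]
  constructor
  · rintro ⟨t, ⟨ht, hK⟩, h⟩
    obtain ⟨rfl, rfl⟩ := Prod.mk.inj h
    exact ⟨(shape_size t).trans ht, _, by rwa [Set.mem_ofPred_eq, ← varCount_eq ht], rfl⟩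
  · rintro ⟨hs, w, hw, rfl⟩
    let w' : ℕ → ℕ × Bool := fun i => if h : i < m + 1 then w ⟨i, h⟩ else (0, true)
    have hsz : (s.label w').size = m + 1 := by
      rw [AOTree.size, ← shape_size, shape_label, hs]
    have hlv : (fun i : Fin (m + 1) => lv (s.label w') i) = w := by
      funext i
      rw [lv_label _ _ _ (by rw [hs]; exact i.2)]
      simp only [w', i.2, dif_pos]
    refine ⟨s.label w', ⟨hsz, ?_⟩, ?_⟩
    · rw [varCount_eq hsz, hlv]
      exact hw
    · rw [code, shape_label, hlv]

lemma TcountEval_false_le {m K : ℕ} {ε : ℝ} (hε : 0 < ε)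
    (h : ∀ i j : Fin (m + 1), i ≠ j → ((clashPatterns (m + 1) K i j).ncard : ℝ) ≤
      ε ^ 2 * (patterns (m + 1) K).ncard) :
    (TcountEval (m + 1) K (fun _ => false) : ℝ) ≤ 39 * ε * Tcount (m + 1) K := by
  classical
  let F : Shape → Set (Fin (m + 1) → Fin (m + 1) → Prop × Prop) := fun s =>
    pattern '' {w : Fin (m + 1) → ℕ × Bool | wordVars w ≤ K ∧
      ∃ i j : Fin (m + 1), (i : ℕ) ∈ cert s ∧ (j : ℕ) ∈ cert s ∧ w j = ((w i).1, !(w i).2)}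
  have hsub : code (m + 1) '' {t | t.size = m + 1 ∧ t.varCount ≤ K ∧ t.eval = fun _ => false} ⊆
      ⋃ s ∈ shapes m, (fun κ => (s, κ)) '' F s := by
    rintro _ ⟨t, ⟨ht, hK, hf⟩, rfl⟩
    have hsz : t.shape.size = m + 1 := (shape_size t).trans ht
    obtain ⟨i, hi, j, hj, hij⟩ := exists_clash hf
    refine Set.mem_biUnion ((mem_shapes _ _).2 hsz) ⟨_, ⟨_, ⟨?_, ?_⟩, rfl⟩, rfl⟩
    · rwa [← varCount_eq ht]
    · exact ⟨⟨i, hsz ▸ lt_size_of_mem_cert _ i hi⟩, ⟨j, hsz ▸ lt_size_of_mem_cert _ j hj⟩,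
        hi, hj, hij⟩
  have hF : ∀ s, ((F s).ncard : ℝ) ≤ (cert s).card * ε * (patterns (m + 1) K).ncard := by
    intro s
    set L := (patterns (m + 1) K).ncard
    set c := (cert s).card
    have h1 : ((F s).ncard : ℝ) ≤ L := by
      refine Nat.cast_le.2 (Set.ncard_le_ncard ?_ (Set.toFinite _))
      exact Set.image_mono fun w hw => hw.1
    have h2 : ((F s).ncard : ℝ) ≤ (c * c : ℕ) * (ε ^ 2 * L) := by
      let D := (Finset.univ : Finset (Fin (m + 1))).filter (fun i : Fin (m + 1) => (i : ℕ) ∈ cert s)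
      have hD : D.card ≤ c :=
        Finset.card_le_card_of_injOn Fin.val (fun i hi => (Finset.mem_filter.1 hi).2)
          Fin.val_injective.injOn
      let Q := (D ×ˢ D).filter (fun ij => ij.1 ≠ ij.2)
      have hQ : Q.card ≤ c * c := (Finset.card_filter_le _ _).trans
        (by rw [Finset.card_product]; exact Nat.mul_le_mul hD hD)
      have hs : F s ⊆ ⋃ ij ∈ Q, clashPatterns (m + 1) K ij.1 ij.2 := by
        rintro _ ⟨w, ⟨hw, i, j, hi, hj, hij⟩, rfl⟩
        have hne : i ≠ j := by
          rintro rfl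
          have := congrArg Prod.snd hij
          simp at this
        exact Set.mem_biUnion (x := (i, j)) (by simp [Q, D, hi, hj, hne]) ⟨w, ⟨hw, hij⟩, rfl⟩
      calc ((F s).ncard : ℝ) ≤ (∑ ij ∈ Q, (clashPatterns (m + 1) K ij.1 ij.2).ncard : ℕ) := by
            refine Nat.cast_le.2 ((Set.ncard_le_ncard hs (Set.toFinite _)).trans ?_)
            exact Finset.set_ncard_biUnion_le _ _
        _ ≤ ∑ ij ∈ Q, ε ^ 2 * L := by
            push_cast
            exact Finset.sum_le_sum fun ij hij => h _ _ (Finset.mem_filter.1 hij).2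
        _ = Q.card * (ε ^ 2 * L) := by simp
        _ ≤ _ := by gcongr
    have hL0 : (0 : ℝ) ≤ L := Nat.cast_nonneg _
    rcases le_total (1 : ℝ) (c * ε) with h3 | h3
    · nlinarith
    · push_cast at h2
      have h4 : (0 : ℝ) ≤ c * ε := by positivity
      calc ((F s).ncard : ℝ) ≤ (c * ε) * (c * ε) * L := by linarith
        _ ≤ 1 * (c * ε) * L := by gcongr
        _ = _ := by ring
  have hfin : (⋃ s ∈ shapes m, (fun κ => (s, κ)) '' F s).Finite :=
    (shapes m).finite_toSet.biUnion fun s _ => Set.toFinite _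
  rw [TcountEval, classCount_eq (n := m + 1) (fun t ht => ht.1), Tcount_eq]
  calc _ ≤ ((∑ s ∈ shapes m, (F s).ncard : ℕ) : ℝ) := by
        refine Nat.cast_le.2 ((Set.ncard_le_ncard hsub hfin).trans ?_)
        refine (Finset.set_ncard_biUnion_le _ _).trans ?_
        exact Finset.sum_le_sum fun s _ => Set.ncard_image_le (Set.toFinite _)
    _ ≤ ∑ s ∈ shapes m, (cert s).card * ε * (patterns (m + 1) K).ncard := by
        push_cast
        exact Finset.sum_le_sum fun s _ => hF s
    _ = (certSum m : ℝ) * (ε * (patterns (m + 1) K).ncard) := by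
        rw [certSum, Nat.cast_sum, Finset.sum_mul]
        exact Finset.sum_congr rfl fun _ _ => by ring
    _ ≤ ((39 * (shapes m).card : ℕ) : ℝ) * (ε * (patterns (m + 1) K).ncard) := by
        gcongr
        exact certSum_le m
    _ = _ := by push_cast; ring

/-- a random Catalan expression is satisfiable with probability
tending to 1: the probability that a uniformly random equivalence class of
and/or trees of size `n` (at most `k_n` variables) computes the constant
function `false` tends to `0`. -/
theorem stmt_1 (k : ℕ → ℕ) (hk_mono : Monotone k)
    (hk_pos : ∀ n, 1 ≤ n → 1 ≤ k n) (hk_le : ∀ n, 1 ≤ n → k n ≤ n)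
    (hk_tend : Tendsto k atTop atTop) :
    Tendsto
      (fun n => (TcountEval n (k n) (fun _ => false) : ℝ) / (Tcount n (k n) : ℝ))
      atTop (nhds 0) := by
  rw [Metric.tendsto_nhds]
  intro ε hε
  filter_upwards [eventually_clashPatterns_le hk_tend (δ := (ε / 40) ^ 2) (by positivity),
    eventually_ge_atTop 1] with n hn hn1
  obtain ⟨m, rfl⟩ := Nat.exists_eq_add_of_le' hn1
  have h := TcountEval_false_le (by positivity) hn
  rw [Real.dist_eq, sub_zero, abs_of_nonneg (by positivity)]
  refine lt_of_le_of_lt (div_le_of_le_mul₀ (Nat.cast_nonneg _) (by positivity) h) ?_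
  linarith

end CatalanSat
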